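/- arXiv:2507.16823 — 2 statements merged into one kernel-verified Lean document; each statement's English description precedes it below -/
import Mathlib

section
/- Let G be the subgroup of the permutation group of (ZMod 4) × (ZMod 4) generated by (x,y) ↦ (−x,y), (x,y) ↦ (x,−y) and (x,y) ↦ (y,x). The G-orbits of (0,1), (1,1) and (1,2) each have exactly 4 elements, the G-orbit of (0,2) has exactly 2 elements, the G-orbit of (2,2) has exactly 1 element, these five orbits are pairwise disjoint, and their union is the set of all 15 nonzero elements of (ZMod 4) × (ZMod 4). -/
/-- The horizontal reflection `(x, y) ↦ (-x, y)` of the 4×4 torus. -/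
def hRefl : Equiv.Perm (ZMod 4 × ZMod 4) := (Equiv.neg (ZMod 4)).prodCongr (Equiv.refl (ZMod 4))

/-- The vertical reflection `(x, y) ↦ (x, -y)` of the 4×4 torus. -/
def vRefl : Equiv.Perm (ZMod 4 × ZMod 4) := (Equiv.refl (ZMod 4)).prodCongr (Equiv.neg (ZMod 4))

/-- The diagonal reflection `(x, y) ↦ (y, x)` of the 4×4 torus. -/
def dRefl : Equiv.Perm (ZMod 4 × ZMod 4) := Equiv.prodComm (ZMod 4) (ZMod 4)

/-- The group of board symmetries fixing the origin. -/
def symG : Subgroup (Equiv.Perm (ZMod 4 × ZMod 4)) := Subgroup.closure {hRefl, vRefl, dRefl}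

/-- The `symG`-orbit of a cell. -/
def orb (v : ZMod 4 × ZMod 4) : Set (ZMod 4 × ZMod 4) := MulAction.orbit symG v

/-- The eight images of a cell, as a finset. -/
def orbFin (v : ZMod 4 × ZMod 4) : Finset (ZMod 4 × ZMod 4) :=
  {(v.1, v.2), (-v.1, v.2), (v.1, -v.2), (-v.1, -v.2),
   (v.2, v.1), (-v.2, v.1), (v.2, -v.1), (-v.2, -v.1)}

theorem orbFin_step : ∀ v w : ZMod 4 × ZMod 4, w ∈ orbFin v →
    hRefl w ∈ orbFin v ∧ vRefl w ∈ orbFin v ∧ dRefl w ∈ orbFin v := by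
  decide +kernel

theorem orb_step (v w : ZMod 4 × ZMod 4) (g : Equiv.Perm (ZMod 4 × ZMod 4)) (hg : g ∈ symG)
    (hw : w ∈ orb v) : g w ∈ orb v := by
  obtain ⟨k, rfl⟩ := hw
  exact ⟨⟨g, hg⟩ * k, rfl⟩

theorem orb_eq (v : ZMod 4 × ZMod 4) : orb v = (orbFin v : Set (ZMod 4 × ZMod 4)) := by
  apply Set.Subset.antisymm
  · rintro _ ⟨⟨g, hg⟩, rfl⟩
    have key : ∀ w, w ∈ orbFin v → g w ∈ orbFin v := by
      refine Subgroup.closure_induction_left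
        (p := fun g _ => ∀ w, w ∈ orbFin v → g w ∈ orbFin v) ?_ ?_ ?_ hg
      · intro w hw
        exact hw
      · rintro x (rfl | rfl | rfl) y _ ih w hw
        · exact (orbFin_step v _ (ih w hw)).1
        · exact (orbFin_step v _ (ih w hw)).2.1
        · exact (orbFin_step v _ (ih w hw)).2.2
      · rintro x (rfl | rfl | rfl) y _ ih w hw
        · exact (orbFin_step v _ (ih w hw)).1
        · exact (orbFin_step v _ (ih w hw)).2.1
        · exact (orbFin_step v _ (ih w hw)).2.2
    exact key v (by simp [orbFin])
  · have h0 : v ∈ orb v := MulAction.mem_orbit_self v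
    have hh : ∀ w, w ∈ orb v → (-w.1, w.2) ∈ orb v := fun w hw =>
      orb_step v w hRefl (Subgroup.subset_closure (by simp)) hw
    have hv : ∀ w, w ∈ orb v → (w.1, -w.2) ∈ orb v := fun w hw =>
      orb_step v w vRefl (Subgroup.subset_closure (by simp)) hw
    have hd : ∀ w, w ∈ orb v → (w.2, w.1) ∈ orb v := fun w hw =>
      orb_step v w dRefl (Subgroup.subset_closure (by simp)) hw
    intro w hw
    simp only [orbFin, Finset.coe_insert, Finset.coe_singleton, Set.mem_insert_iff,
      Set.mem_singleton_iff] at hw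
    rcases hw with rfl | rfl | rfl | rfl | rfl | rfl | rfl | rfl
    · exact h0
    · exact hh _ h0
    · exact hv _ h0
    · exact hv _ (hh _ h0)
    · exact hd _ h0
    · exact hh _ (hd _ h0)
    · exact hv _ (hd _ h0)
    · exact hv _ (hh _ (hd _ h0))

theorem orbit_sizes_disjoint_union :
    (orb (0, 1)).ncard = 4 ∧ (orb (1, 1)).ncard = 4 ∧ (orb (1, 2)).ncard = 4 ∧
    (orb (0, 2)).ncard = 2 ∧ (orb (2, 2)).ncard = 1 ∧
    Disjoint (orb (0, 1)) (orb (1, 1)) ∧ Disjoint (orb (0, 1)) (orb (1, 2)) ∧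
    Disjoint (orb (0, 1)) (orb (0, 2)) ∧ Disjoint (orb (0, 1)) (orb (2, 2)) ∧
    Disjoint (orb (1, 1)) (orb (1, 2)) ∧ Disjoint (orb (1, 1)) (orb (0, 2)) ∧
    Disjoint (orb (1, 1)) (orb (2, 2)) ∧ Disjoint (orb (1, 2)) (orb (0, 2)) ∧
    Disjoint (orb (1, 2)) (orb (2, 2)) ∧ Disjoint (orb (0, 2)) (orb (2, 2)) ∧
    orb (0, 1) ∪ orb (1, 1) ∪ orb (1, 2) ∪ orb (0, 2) ∪ orb (2, 2) =
      {v : ZMod 4 × ZMod 4 | v ≠ 0} := by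
  have hset : {v : ZMod 4 × ZMod 4 | v ≠ 0} =
      ((Finset.univ.filter (fun v : ZMod 4 × ZMod 4 => v ≠ 0) : Finset (ZMod 4 × ZMod 4)) :
        Set (ZMod 4 × ZMod 4)) := by
    ext v
    simp
  rw [hset]
  simp only [orb_eq, Set.ncard_coe_finset, Finset.disjoint_coe, ← Finset.coe_union,
    Finset.coe_inj]
  decide +kernel
end

section
/- Let G be the subgroup of the permutation group of (ZMod 4) × (ZMod 4) generated by (x,y) ↦ (−x,y), (x,y) ↦ (x,−y) and (x,y) ↦ (y,x), and for x ∈ ZMod 4 let d(x) = min(x.val, 4 − x.val). Two nonzero elements v and w of (ZMod 4) × (ZMod 4) lie in the same G-orbit if and only if the multisets {d(v.1), d(v.2)} and {d(w.1), d(w.2)} are equal. -/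
/-- The circular distance from `x` to `0` in `ZMod 4`. -/
def cdist (x : ZMod 4) : ℕ := min x.val (4 - x.val)

theorem cdist_neg_aux : ∀ x : ZMod 4, cdist (-x) = cdist x := by decide

/-- Every element of `symG` preserves the multiset of distances. -/
theorem symG_preserves (g : Equiv.Perm (ZMod 4 × ZMod 4)) (hg : g ∈ symG) :
    ∀ v : ZMod 4 × ZMod 4, ({cdist (g v).1, cdist (g v).2} : Multiset ℕ) =
      ({cdist v.1, cdist v.2} : Multiset ℕ) := by
  unfold symG at hg
  induction hg using Subgroup.closure_induction with
  | mem x hx =>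
    intro v
    rcases hx with rfl | rfl | rfl
    · simp [hRefl, cdist_neg_aux]
    · simp [vRefl, cdist_neg_aux]
    · simpa [dRefl] using Multiset.pair_comm _ _
  | one => intro v; rfl
  | mul x y _ _ hx hy => intro v; rw [Equiv.Perm.mul_apply, hx, hy]
  | inv x _ hx => intro v; simpa using (hx (x⁻¹ v)).symm

theorem cdist_eq_aux : ∀ x y : ZMod 4, cdist x = cdist y → y = x ∨ y = -x := by decide

/-- Cells with coordinatewise equal distances lie in the same orbit. -/
theorem exists_of_cdist_eq (v w : ZMod 4 × ZMod 4) (h1 : cdist v.1 = cdist w.1)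
    (h2 : cdist v.2 = cdist w.2) : ∃ g ∈ symG, g v = w := by
  have hh : hRefl ∈ symG := Subgroup.subset_closure (by simp)
  have hv : vRefl ∈ symG := Subgroup.subset_closure (by simp)
  obtain ⟨a, b⟩ := v
  obtain ⟨c, d⟩ := w
  rcases cdist_eq_aux _ _ h1 with h | h <;> rcases cdist_eq_aux _ _ h2 with h' | h' <;>
    simp only at h h' <;> subst h <;> subst h'
  · exact ⟨1, one_mem _, rfl⟩
  · exact ⟨vRefl, hv, rfl⟩
  · exact ⟨hRefl, hh, rfl⟩
  · exact ⟨hRefl * vRefl, mul_mem hh hv, rfl⟩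

theorem same_orbit_iff_same_distance_multiset (v w : ZMod 4 × ZMod 4)
    (hv : v ≠ 0) (hw : w ≠ 0) :
    w ∈ MulAction.orbit symG v ↔
      ({cdist v.1, cdist v.2} : Multiset ℕ) = ({cdist w.1, cdist w.2} : Multiset ℕ) := by
  constructor
  · rintro ⟨⟨g, hg⟩, rfl⟩
    exact (symG_preserves g hg v).symm
  · intro h
    have key : ∃ g ∈ symG, g v = w := by
      have hd : dRefl ∈ symG := Subgroup.subset_closure (by simp)
      have h' : (cdist v.1 = cdist w.1 ∧ cdist v.2 = cdist w.2) ∨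
          (cdist v.1 = cdist w.2 ∧ cdist v.2 = cdist w.1) := by
        have := Multiset.cons_eq_cons.mp h
        rcases this with ⟨h1, h2⟩ | ⟨_, cs, h1, h2⟩
        · exact Or.inl ⟨h1, by simpa using h2⟩
        · rw [Multiset.singleton_eq_cons_iff] at h1 h2
          exact Or.inr ⟨h2.1.symm, h1.1⟩
      rcases h' with ⟨h1, h2⟩ | ⟨h1, h2⟩
      · exact exists_of_cdist_eq v w h1 h2
      · obtain ⟨g, hg, e⟩ := exists_of_cdist_eq (dRefl v) w h2 h1
        exact ⟨g * dRefl, mul_mem hg hd, e⟩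
    obtain ⟨g, hg, e⟩ := key
    exact ⟨⟨g, hg⟩, e⟩
end
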